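/- A Z^v-graded ideal I of S is a Cartwright-Sturmfels* ideal if and only if gin_τ(I) is extended from T (i.e. generated by monomials in the variables x_{11},...,x_{v1}) for some term order τ, if and only if gin_τ(I) is extended from T for every term order τ. -/

import Mathlib

open MvPolynomial

noncomputable section

namespace CSPaper

/-- The set of variables of the standard `ℤ^v`-graded polynomial ring `S`:
the variable `x_{i j}` of the paper (with `1 ≤ i ≤ v`, `1 ≤ j ≤ n_i`) corresponds to
`⟨i-1, j-1⟩ : MVar v n` where `n (i-1) = n_i - 1`; thus row `i` has `n i + 1 > 0`
variables and the first variable `x_{i 1}` of row `i` corresponds to `⟨i, 0⟩`. -/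
abbrev MVar (v : ℕ) (n : Fin v → ℕ) : Type := Σ i : Fin v, Fin (n i + 1)

/-- The weight function giving the standard `ℤ^v`-grading: `deg (x_{i j}) = e_i ∈ ℤ^v`. -/
def wt (v : ℕ) (n : Fin v → ℕ) : MVar v n → (Fin v → ℕ) := fun p => Pi.single p.1 1

variable {K : Type} [Field K] {v : ℕ} {n : Fin v → ℕ}

/-- An ideal of `S` is `ℤ^v`-graded (multigraded) iff it contains every multihomogeneous
component of each of its elements. -/
def IsMultigraded (I : Ideal (MvPolynomial (MVar v n) K)) : Prop :=
  ∀ f ∈ I, ∀ a : Fin v → ℕ, weightedHomogeneousComponent (wt v n) a f ∈ I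

/-- The value of the `ℤ^v`-graded Hilbert function of the ideal `I` at `a ∈ ℕ^v`:
`dim_K I_a`. -/
def hilb (I : Ideal (MvPolynomial (MVar v n) K)) (a : Fin v → ℕ) : ℕ :=
  Module.finrank K
    ((Submodule.restrictScalars K I ⊓ weightedHomogeneousSubmodule K (wt v n) a :
      Submodule K (MvPolynomial (MVar v n) K)))

/-- Two ideals have the same `ℤ^v`-graded Hilbert series. -/
def sameHS (I J : Ideal (MvPolynomial (MVar v n) K)) : Prop :=
  ∀ a : Fin v → ℕ, hilb I a = hilb J a

/-- The `ℤ^v`-graded `K`-algebra endomorphism of `S` determined by a `v`-tuple of square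
matrices: `x_{i j} ↦ ∑_k (g i)_{k j} x_{i k}`.  For invertible `g i` these are exactly the
elements of `G = GL_{n_1}(K) × ⋯ × GL_{n_v}(K)` acting on `S`. -/
def gAct (g : ∀ i : Fin v, Matrix (Fin (n i + 1)) (Fin (n i + 1)) K) :
    MvPolynomial (MVar v n) K →ₐ[K] MvPolynomial (MVar v n) K :=
  aeval fun p : MVar v n => ∑ k : Fin (n p.1 + 1), C (g p.1 k p.2) * X ⟨p.1, k⟩

/-- A property `P` of `v`-tuples of matrices holds generically (i.e. for a general
`g ∈ GL_{n_1}(K) × ⋯ × GL_{n_v}(K)`) if there is a nonzero polynomial `h` in the matrix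
entries such that `P g` holds for every invertible `g` with `h(g) ≠ 0`. -/
def Generically
    (P : (∀ i : Fin v, Matrix (Fin (n i + 1)) (Fin (n i + 1)) K) → Prop) : Prop :=
  ∃ h : MvPolynomial (Σ i : Fin v, Fin (n i + 1) × Fin (n i + 1)) K, h ≠ 0 ∧
    ∀ g : ∀ i : Fin v, Matrix (Fin (n i + 1)) (Fin (n i + 1)) K,
      (∀ i, IsUnit (g i).det) →
      eval (fun q : Σ i : Fin v, Fin (n i + 1) × Fin (n i + 1) => g q.1 q.2.1 q.2.2) h ≠ 0 →
      P g

/-- The leading exponent (exponent of the leading monomial) of a polynomial with respect to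
a term order `τ` (a `MonomialOrder`); by convention `leadExp τ 0 = 0`. -/
def leadExp (τ : MonomialOrder (MVar v n)) (f : MvPolynomial (MVar v n) K) :
    MVar v n →₀ ℕ :=
  τ.toSyn.symm (f.support.sup τ.toSyn)

/-- The initial ideal `in_τ(I)`: the monomial ideal generated by the leading monomials of the
nonzero elements of `I`. -/
def inIdeal (τ : MonomialOrder (MVar v n)) (I : Ideal (MvPolynomial (MVar v n) K)) :
    Ideal (MvPolynomial (MVar v n) K) :=
  Ideal.span {m | ∃ f ∈ I, f ≠ 0 ∧ m = monomial (leadExp τ f) (1 : K)}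

/-- `G` is a Gröbner basis of `I` with respect to the term order `τ`. -/
def IsGroebnerBasis (τ : MonomialOrder (MVar v n)) (G : Set (MvPolynomial (MVar v n) K))
    (I : Ideal (MvPolynomial (MVar v n) K)) : Prop :=
  G ⊆ (I : Set (MvPolynomial (MVar v n) K)) ∧
    Ideal.span ((fun f => monomial (leadExp τ f) (1 : K)) '' {f ∈ G | f ≠ 0}) = inIdeal τ I

/-- `J = gin_τ(I)`, the `ℤ^v`-graded generic initial ideal: for a general
`g ∈ GL_{n_1}(K) × ⋯ × GL_{n_v}(K)` one has `in_τ(g(I)) = J`. -/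
def IsGin (τ : MonomialOrder (MVar v n)) (I J : Ideal (MvPolynomial (MVar v n) K)) : Prop :=
  Generically fun g => inIdeal τ (Ideal.map (gAct g) I) = J

/-- A term order such that `x_{i j} > x_{i k}` whenever `j < k`. -/
def RespectsVarOrder (τ : MonomialOrder (MVar v n)) : Prop :=
  ∀ (i : Fin v) (j k : Fin (n i + 1)), j < k →
    τ.toSyn (Finsupp.single (⟨i, k⟩ : MVar v n) 1) <
      τ.toSyn (Finsupp.single (⟨i, j⟩ : MVar v n) 1)

/-- An ideal is Borel fixed if it is fixed by every element of the Borel subgroup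
`B = B_{n_1}(K) × ⋯ × B_{n_v}(K)` of upper triangular invertible matrices (upper triangular
with respect to the order `x_{i 1} > x_{i 2} > ⋯` of the variables in each row). -/
def BorelFixed (I : Ideal (MvPolynomial (MVar v n) K)) : Prop :=
  ∀ g : ∀ i : Fin v, Matrix (Fin (n i + 1)) (Fin (n i + 1)) K,
    (∀ i, IsUnit (g i).det) →
    (∀ (i : Fin v) (k j : Fin (n i + 1)), j < k → g i k j = 0) →
    Ideal.map (gAct g) I = I

/-- A Cartwright-Sturmfels ideal: a `ℤ^v`-graded ideal with the same `ℤ^v`-graded Hilbert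
series as some radical Borel fixed ideal. -/
def IsCS (I : Ideal (MvPolynomial (MVar v n) K)) : Prop :=
  IsMultigraded I ∧ ∃ J : Ideal (MvPolynomial (MVar v n) K),
    J.IsRadical ∧ BorelFixed J ∧ sameHS I J

/-- The exponent of the monomial `x_{1 1}^{a 1} ⋯ x_{v 1}^{a v}` of
`T = K[x_{1 1}, …, x_{v 1}] ⊆ S`. -/
def Tmono (v : ℕ) (n : Fin v → ℕ) (a : Fin v → ℕ) : MVar v n →₀ ℕ :=
  ∑ i : Fin v, Finsupp.single (⟨i, 0⟩ : MVar v n) (a i)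

/-- A `ℤ^v`-graded ideal of `S` extended from `T`, i.e. generated by monomials in the
variables `x_{1 1}, …, x_{v 1}`. -/
def ExtendedFromT (J : Ideal (MvPolynomial (MVar v n) K)) : Prop :=
  ∃ A : Set (Fin v → ℕ),
    J = Ideal.span ((fun a => monomial (Tmono v n a) (1 : K)) '' A)

/-- A Cartwright-Sturmfels* ideal: a `ℤ^v`-graded ideal with the same `ℤ^v`-graded Hilbert
series as some ideal extended from `T`. -/
def IsCSstar (J : Ideal (MvPolynomial (MVar v n) K)) : Prop :=
  IsMultigraded J ∧ ∃ C : Ideal (MvPolynomial (MVar v n) K), ExtendedFromT C ∧ sameHS J C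

/-- A monomial ideal. -/
def IsMonomialIdeal (I : Ideal (MvPolynomial (MVar v n) K)) : Prop :=
  ∃ A : Set (MVar v n →₀ ℕ), I = Ideal.span ((fun s => monomial s (1 : K)) '' A)

/-- A squarefree monomial ideal. -/
def IsSqfreeMonomialIdeal (I : Ideal (MvPolynomial (MVar v n) K)) : Prop :=
  ∃ A : Set (MVar v n →₀ ℕ), (∀ s ∈ A, ∀ x, s x ≤ 1) ∧
    I = Ideal.span ((fun s => monomial s (1 : K)) '' A)

/-- `J` is the Alexander dual of the squarefree monomial ideal `I`: `J` is generated by the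
products `∏_{x ∈ P} x` as `P` ranges over the minimal primes of `I`. -/
def IsAlexanderDual (I J : Ideal (MvPolynomial (MVar v n) K)) : Prop :=
  J = Ideal.span {m | ∃ F : Finset (MVar v n),
    Ideal.span ((fun x => (X x : MvPolynomial (MVar v n) K)) '' ↑F) ∈ I.minimalPrimes ∧
    m = ∏ x ∈ F, X x}

/-- The sequence `x_{i j} - λ_{i j} x_{i 1}`, `1 ≤ i ≤ v`, `2 ≤ j ≤ n_i`, as a list. -/
def LamList (lam : MVar v n → K) : List (MvPolynomial (MVar v n) K) :=
  (List.finRange v).flatMap fun i =>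
    ((List.finRange (n i + 1)).drop 1).map fun j =>
      X (⟨i, j⟩ : MVar v n) - C (lam ⟨i, j⟩) * X (⟨i, 0⟩ : MVar v n)

/-- A property of the scalars `λ = (λ_{i j})` holds for general `λ ∈ K^N` if there is a
nonzero polynomial `h` in the `λ_{i j}` such that the property holds whenever `h(λ) ≠ 0`. -/
def GenericallyLam {v : ℕ} {n : Fin v → ℕ} (K : Type) [Field K]
    (P : (MVar v n → K) → Prop) : Prop :=
  ∃ h : MvPolynomial (MVar v n) K, h ≠ 0 ∧
    ∀ lam : MVar v n → K, eval lam h ≠ 0 → P lam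

variable {K : Type} [Field K] {v : ℕ} {n : Fin v → ℕ}

/-- A graded free resolution of an ideal `I` of a polynomial ring graded by an additive
monoid `M` via a weight function `w` on the variables:
`⋯ → F_2 → F_1 → F_0 → I → 0`, where `F_p` is the free module with (finite) basis `ι p`,
the basis element `i : ι p` having degree `deg p i ∈ M`, all maps are graded of degree `0`,
and the complex is exact. -/
structure GradedFreeResolution (σ : Type) (K : Type) [Field K] (M : Type) [AddCommMonoid M]
    (w : σ → M) (I : Ideal (MvPolynomial σ K)) where
  ι : ℕ → Type
  finite : ∀ p, Finite (ι p)
  deg : ∀ p, ι p → M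
  aug : (ι 0 →₀ MvPolynomial σ K) →ₗ[MvPolynomial σ K] MvPolynomial σ K
  d : ∀ p, (ι (p + 1) →₀ MvPolynomial σ K) →ₗ[MvPolynomial σ K] (ι p →₀ MvPolynomial σ K)
  aug_graded : ∀ i : ι 0, (aug (Finsupp.single i 1)).IsWeightedHomogeneous w (deg 0 i)
  d_graded : ∀ (p : ℕ) (i : ι (p + 1)) (j : ι p),
    (d p (Finsupp.single i 1)) j = 0 ∨
      ∃ b, ((d p (Finsupp.single i 1)) j).IsWeightedHomogeneous w b ∧
        b + deg p j = deg (p + 1) i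
  range_aug : LinearMap.range aug = (I : Submodule (MvPolynomial σ K) (MvPolynomial σ K))
  exact_zero : LinearMap.ker aug = LinearMap.range (d 0)
  exact : ∀ p, LinearMap.ker (d p) = LinearMap.range (d (p + 1))

/-- A graded free resolution is minimal if all entries of the matrices of the differentials
between free modules lie in the irrelevant maximal ideal, i.e. have zero constant term. -/
def GradedFreeResolution.Minimal {σ M : Type} [AddCommMonoid M] {w : σ → M}
    {I : Ideal (MvPolynomial σ K)} (F : GradedFreeResolution σ K M w I) : Prop :=
  ∀ (p : ℕ) (i : F.ι (p + 1)) (j : F.ι p),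
    MvPolynomial.constantCoeff ((F.d p (Finsupp.single i 1)) j) = 0

/-- The graded Betti number `β_{p,a}` read off from a (minimal) graded free resolution:
the number of basis elements of `F_p` of degree `a`. -/
def GradedFreeResolution.betti {σ M : Type} [AddCommMonoid M] {w : σ → M}
    {I : Ideal (MvPolynomial σ K)} (F : GradedFreeResolution σ K M w I) (p : ℕ) (a : M) :
    ℕ :=
  Nat.card {i : F.ι p // F.deg p i = a}

/-- The set of `t × t` minors of the matrix `A`. -/
def minorsSet {R : Type} [CommRing R] (t : ℕ) {m N : ℕ} (A : Matrix (Fin m) (Fin N) R) :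
    Set R :=
  {d | ∃ (r : Fin t → Fin m) (c : Fin t → Fin N),
    Function.Injective r ∧ Function.Injective c ∧ d = (A.submatrix r c).det}

/-- `I_t(A)`, the ideal generated by the `t × t` minors of `A`. -/
def minorsIdeal {R : Type} [CommRing R] (t : ℕ) {m N : ℕ}
    (A : Matrix (Fin m) (Fin N) R) : Ideal R :=
  Ideal.span (minorsSet t A)

/-- `A` is column-graded: `N ≤ v` and each entry of the `j`-th column is either `0` or
multihomogeneous of degree `e_j ∈ ℤ^v`. -/
def ColumnGraded {m N : ℕ} (A : Matrix (Fin m) (Fin N) (MvPolynomial (MVar v n) K)) :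
    Prop :=
  ∃ h : N ≤ v, ∀ i j, A i j = 0 ∨
    (A i j).IsWeightedHomogeneous (wt v n) (Pi.single (Fin.castLE h j) 1)

/-- `A` is row-graded: `m ≤ v` and each entry of the `i`-th row is either `0` or
multihomogeneous of degree `e_i ∈ ℤ^v`. -/
def RowGraded {m N : ℕ} (A : Matrix (Fin m) (Fin N) (MvPolynomial (MVar v n) K)) : Prop :=
  ∃ h : m ≤ v, ∀ i j, A i j = 0 ∨
    (A i j).IsWeightedHomogeneous (wt v n) (Pi.single (Fin.castLE h i) 1)

/-- The exponent of the polarization of the monomial `x_{1 1}^{a 1} ⋯ x_{v 1}^{a v}` of `T`: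
the squarefree monomial `∏_i x_{i 1} x_{i 2} ⋯ x_{i (a i)}`. -/
def polExp (v : ℕ) (n : Fin v → ℕ) (a : Fin v → ℕ) : MVar v n →₀ ℕ :=
  ∑ i : Fin v, ∑ j ∈ Finset.univ.filter (fun j : Fin (n i + 1) => (j : ℕ) < a i),
    Finsupp.single (⟨i, j⟩ : MVar v n) 1

/-- `P = pol(C)`, the polarization of an ideal `C` extended from `T`
(the exponents of the generators of `C` must fit inside `S`). -/
def IsPolarizationOfT (C P : Ideal (MvPolynomial (MVar v n) K)) : Prop :=
  ∃ A : Set (Fin v → ℕ), (∀ a ∈ A, ∀ i, a i ≤ n i + 1) ∧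
    C = Ideal.span ((fun a => monomial (Tmono v n a) (1 : K)) '' A) ∧
    P = Ideal.span ((fun a => monomial (polExp v n a) (1 : K)) '' A)

/-- `ψ` is an identification of the quotient of `S` by the `ℤ^v`-graded ideal `Q` with a
standard `ℤ^v`-graded polynomial ring, compatible with the gradings. -/
def IsGradedStructureIso {n₂ : Fin v → ℕ} (Q : Ideal (MvPolynomial (MVar v n) K))
    (ψ : (MvPolynomial (MVar v n) K ⧸ Q) ≃ₐ[K] MvPolynomial (MVar v n₂) K) : Prop :=
  ∀ (f : MvPolynomial (MVar v n) K) (a : Fin v → ℕ),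
    f.IsWeightedHomogeneous (wt v n) a →
      (ψ (Ideal.Quotient.mk Q f)).IsWeightedHomogeneous (wt v n₂) a

end CSPaper

open CSPaper

namespace CSPaper

section GeneralLinearAction

variable {K : Type} [Field K] {v : ℕ} {n : Fin v → ℕ}

lemma gAct_X (g : ∀ i : Fin v, Matrix (Fin (n i + 1)) (Fin (n i + 1)) K) (p : MVar v n) :
    gAct g (X p) = ∑ k : Fin (n p.1 + 1), C (g p.1 k p.2) * X ⟨p.1, k⟩ := by
  simp [gAct]

lemma gAct_comp (g h : ∀ i : Fin v, Matrix (Fin (n i + 1)) (Fin (n i + 1)) K) :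
    (gAct g).comp (gAct h) = gAct (fun i => g i * h i) := by
  ext1 p
  simp only [AlgHom.comp_apply, gAct_X, map_sum, map_mul, algHom_C, Matrix.mul_apply,
    Finset.sum_mul, Finset.mul_sum, algebraMap_eq]
  rw [Finset.sum_comm]
  refine Finset.sum_congr rfl fun k _ => Finset.sum_congr rfl fun l _ => ?_
  ring

lemma gAct_one : gAct (fun i => (1 : Matrix (Fin (n i + 1)) (Fin (n i + 1)) K)) =
    AlgHom.id K (MvPolynomial (MVar v n) K) := by
  ext1 p
  simp [gAct_X, Matrix.one_apply]

/-- The graded algebra automorphism given by a tuple of invertible matrices. -/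
def gActEquiv (g : ∀ i : Fin v, Matrix (Fin (n i + 1)) (Fin (n i + 1)) K)
    (hg : ∀ i, IsUnit (g i).det) :
    MvPolynomial (MVar v n) K ≃ₐ[K] MvPolynomial (MVar v n) K :=
  AlgEquiv.ofAlgHom (gAct g) (gAct fun i => (g i)⁻¹)
    (by rw [gAct_comp, ← gAct_one]; congr; funext i; exact Matrix.mul_nonsing_inv _ (hg i))
    (by rw [gAct_comp, ← gAct_one]; congr; funext i; exact Matrix.nonsing_inv_mul _ (hg i))

lemma gAct_monomial_isWeightedHomogeneous
    (g : ∀ i : Fin v, Matrix (Fin (n i + 1)) (Fin (n i + 1)) K) (d : MVar v n →₀ ℕ) (c : K) :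
    (gAct g (monomial d c)).IsWeightedHomogeneous (wt v n) (Finsupp.weight (wt v n) d) := by
  rw [gAct, aeval_monomial, Finsupp.weight_apply]
  refine (IsWeightedHomogeneous.prod d.support _ (fun p => d p • wt v n p)
    fun p _ => IsWeightedHomogeneous.pow ?_ _).C_mul c
  exact IsWeightedHomogeneous.sum _ _ _ fun k _ => (isWeightedHomogeneous_X K _ _).C_mul _

lemma weightedHomogeneousComponent_gAct
    (g : ∀ i : Fin v, Matrix (Fin (n i + 1)) (Fin (n i + 1)) K) (a : Fin v → ℕ)
    (f : MvPolynomial (MVar v n) K) :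
    weightedHomogeneousComponent (wt v n) a (gAct g f) =
      gAct g (weightedHomogeneousComponent (wt v n) a f) := by
  suffices h : weightedHomogeneousComponent (wt v n) a ∘ₗ (gAct g).toLinearMap =
      (gAct g).toLinearMap ∘ₗ weightedHomogeneousComponent (wt v n) a from
    LinearMap.congr_fun h f
  refine MvPolynomial.linearMap_ext fun d => LinearMap.ext fun c => ?_
  have h := weightedHomogeneousComponent_of_mem (m := a)
    (gAct_monomial_isWeightedHomogeneous (n := n) g d c)
  have h' := weightedHomogeneousComponent_of_mem (m := a)
    (isWeightedHomogeneous_monomial (wt v n) d c rfl)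
  simp only [LinearMap.comp_apply, AlgHom.toLinearMap_apply]
  rw [h, h']
  split_ifs <;> simp

lemma gAct_mem_weightedHomogeneousSubmodule_iff
    (g : ∀ i : Fin v, Matrix (Fin (n i + 1)) (Fin (n i + 1)) K) (hg : ∀ i, IsUnit (g i).det)
    (a : Fin v → ℕ) (f : MvPolynomial (MVar v n) K) :
    gAct g f ∈ weightedHomogeneousSubmodule K (wt v n) a ↔
      f ∈ weightedHomogeneousSubmodule K (wt v n) a := by
  have key : ∀ p : MvPolynomial (MVar v n) K, p ∈ weightedHomogeneousSubmodule K (wt v n) a ↔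
      weightedHomogeneousComponent (wt v n) a p = p := fun p =>
    ⟨fun h => IsWeightedHomogeneous.weightedHomogeneousComponent_same h,
      fun h => h ▸ weightedHomogeneousComponent_mem (wt v n) p a⟩
  rw [key, key, weightedHomogeneousComponent_gAct]
  exact (gActEquiv g hg).injective.eq_iff

lemma mem_map_gAct_iff
    (g : ∀ i : Fin v, Matrix (Fin (n i + 1)) (Fin (n i + 1)) K) (hg : ∀ i, IsUnit (g i).det)
    (I : Ideal (MvPolynomial (MVar v n) K)) (f : MvPolynomial (MVar v n) K) :
    f ∈ Ideal.map (gAct g) I ↔ ∃ p ∈ I, gAct g p = f :=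
  Ideal.mem_map_iff_of_surjective (gAct g) (gActEquiv g hg).surjective

lemma IsMultigraded.map_gAct {I : Ideal (MvPolynomial (MVar v n) K)} (hI : IsMultigraded I)
    (g : ∀ i : Fin v, Matrix (Fin (n i + 1)) (Fin (n i + 1)) K) (hg : ∀ i, IsUnit (g i).det) :
    IsMultigraded (Ideal.map (gAct g) I) := by
  intro f hf a
  obtain ⟨p, hp, rfl⟩ := (mem_map_gAct_iff g hg I f).1 hf
  rw [weightedHomogeneousComponent_gAct]
  exact Ideal.mem_map_of_mem _ (hI p hp a)

lemma hilb_map_gAct (I : Ideal (MvPolynomial (MVar v n) K))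
    (g : ∀ i : Fin v, Matrix (Fin (n i + 1)) (Fin (n i + 1)) K) (hg : ∀ i, IsUnit (g i).det)
    (a : Fin v → ℕ) : hilb (Ideal.map (gAct g) I) a = hilb I a := by
  have h : (Submodule.restrictScalars K (Ideal.map (gAct g) I) ⊓
        weightedHomogeneousSubmodule K (wt v n) a) =
      (Submodule.restrictScalars K I ⊓ weightedHomogeneousSubmodule K (wt v n) a).map
        (gActEquiv g hg).toLinearEquiv.toLinearMap := by
    ext f
    simp only [Submodule.mem_inf, Submodule.restrictScalars_mem, mem_map_gAct_iff g hg,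
      Submodule.mem_map]
    constructor
    · rintro ⟨⟨p, hp, rfl⟩, hf⟩
      exact ⟨p, ⟨hp, (gAct_mem_weightedHomogeneousSubmodule_iff g hg a p).1 hf⟩, rfl⟩
    · rintro ⟨p, ⟨hp, hp'⟩, rfl⟩
      exact ⟨⟨p, hp, rfl⟩, (gAct_mem_weightedHomogeneousSubmodule_iff g hg a p).2 hp'⟩
  rw [hilb, hilb, h]
  exact LinearEquiv.finrank_map_eq (gActEquiv g hg).toLinearEquiv _

/-- A nonvanishing condition on the entries of a tuple of matrices over an infinite field is
satisfied by some tuple of invertible matrices. -/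
lemma exists_isUnit_det_eval_ne_zero [Infinite K]
    {h : MvPolynomial (Σ i : Fin v, Fin (n i + 1) × Fin (n i + 1)) K} (hh : h ≠ 0) :
    ∃ g : ∀ i : Fin v, Matrix (Fin (n i + 1)) (Fin (n i + 1)) K,
      (∀ i, IsUnit (g i).det) ∧
      eval (fun q : Σ i : Fin v, Fin (n i + 1) × Fin (n i + 1) => g q.1 q.2.1 q.2.2) h ≠ 0 := by
  let D : Fin v → MvPolynomial (Σ i : Fin v, Fin (n i + 1) × Fin (n i + 1)) K := fun i =>
    Matrix.det (Matrix.of fun k j => X ⟨i, (k, j)⟩)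
  have eval_D : ∀ (x : (Σ i : Fin v, Fin (n i + 1) × Fin (n i + 1)) → K) i,
      eval x (D i) = Matrix.det (Matrix.of fun k j => x ⟨i, (k, j)⟩) := by
    intro x i
    simp only [D, RingHom.map_det]
    congr 1
    ext k j
    simp
  have hD : ∀ i, D i ≠ 0 := by
    intro i h0
    have := eval_D (fun q => (1 : Matrix (Fin (n q.1 + 1)) (Fin (n q.1 + 1)) K) q.2.1 q.2.2) i
    rw [h0, map_zero] at this
    exact zero_ne_one (this.trans Matrix.det_one)
  have hne : h * ∏ i, D i ≠ 0 := mul_ne_zero hh (Finset.prod_ne_zero_iff.2 fun i _ => hD i)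
  obtain ⟨x, hx⟩ : ∃ x, eval x (h * ∏ i, D i) ≠ 0 := by
    by_contra! hx
    exact hne (MvPolynomial.funext fun x => by rw [hx, map_zero])
  rw [map_mul, map_prod] at hx
  refine ⟨fun i => Matrix.of fun k j => x ⟨i, (k, j)⟩, fun i => ?_, left_ne_zero_of_mul hx⟩
  rw [isUnit_iff_ne_zero, ← eval_D]
  exact Finset.prod_ne_zero_iff.1 (right_ne_zero_of_mul hx) i (Finset.mem_univ i)

end GeneralLinearAction

section InitialIdeal

variable {K : Type} [Field K] {v : ℕ} {n : Fin v → ℕ}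

lemma weight_wt_apply (d : MVar v n →₀ ℕ) (i : Fin v) :
    Finsupp.weight (wt v n) d i = ∑ j, d ⟨i, j⟩ := by
  rw [Finsupp.weight_eq_sum, Finset.sum_apply, Fintype.sum_sigma]
  simp [wt, Pi.single_apply, Finset.sum_ite_eq]

lemma finite_weight_eq (a : Fin v → ℕ) :
    {d : MVar v n →₀ ℕ | Finsupp.weight (wt v n) d = a}.Finite := by
  refine (Set.finite_Iic (Finsupp.equivFunOnFinite.symm fun p : MVar v n => a p.1)).subset ?_
  rintro d rfl p
  simp only [Finsupp.equivFunOnFinite_symm_apply_apply, weight_wt_apply]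
  exact Finset.single_le_sum (f := fun j => d ⟨p.1, j⟩) (fun _ _ => Nat.zero_le _)
    (Finset.mem_univ p.2)

instance finite_weightedHomogeneousSubmodule (a : Fin v → ℕ) :
    Module.Finite K (weightedHomogeneousSubmodule K (wt v n) a) := by
  have := (finite_weight_eq (n := n) a).to_subtype
  have h : weightedHomogeneousSubmodule K (wt v n) a =
      restrictSupport K {d | Finsupp.weight (wt v n) d = a} := by
    ext f
    rw [mem_restrictSupport_iff]
    exact ⟨fun h d hd => h (by simpa using hd), fun h d hd => h (by simpa using hd)⟩
  rw [h]
  exact Module.Finite.of_basis (basisRestrictSupport K _)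

/-- The exponents of the leading monomials of the nonzero elements of an ideal. -/
def leadExps (τ : MonomialOrder (MVar v n)) (I : Ideal (MvPolynomial (MVar v n) K)) :
    Set (MVar v n →₀ ℕ) :=
  {d | ∃ f ∈ I, f ≠ 0 ∧ τ.degree f = d}

lemma inIdeal_eq_span (τ : MonomialOrder (MVar v n)) (I : Ideal (MvPolynomial (MVar v n) K)) :
    inIdeal τ I = Ideal.span ((fun d => monomial d (1 : K)) '' leadExps τ I) := by
  rw [inIdeal]
  congr 1
  ext m
  constructor
  · rintro ⟨f, hf, h0, rfl⟩
    exact ⟨_, ⟨f, hf, h0, rfl⟩, rfl⟩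
  · rintro ⟨_, ⟨f, hf, h0, rfl⟩, rfl⟩
    exact ⟨f, hf, h0, rfl⟩

lemma leadExps_isUpperSet (τ : MonomialOrder (MVar v n))
    (I : Ideal (MvPolynomial (MVar v n) K)) : IsUpperSet (leadExps τ I) := by
  rintro _ e hde ⟨f, hf, h0, rfl⟩
  obtain ⟨c, rfl⟩ := exists_add_of_le hde
  have hc : monomial c (1 : K) ≠ 0 := by simp
  refine ⟨f * monomial c 1, I.mul_mem_right _ hf, mul_ne_zero h0 hc, ?_⟩
  classical
  rw [τ.degree_mul h0 hc, τ.degree_monomial, if_neg one_ne_zero]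

lemma mem_inIdeal_iff (τ : MonomialOrder (MVar v n)) (I : Ideal (MvPolynomial (MVar v n) K))
    (f : MvPolynomial (MVar v n) K) :
    f ∈ inIdeal τ I ↔ ∀ d ∈ f.support, d ∈ leadExps τ I := by
  rw [inIdeal_eq_span, mem_ideal_span_monomial_image]
  exact forall₂_congr fun d _ =>
    ⟨fun ⟨e, he, hed⟩ => leadExps_isUpperSet τ I hed he, fun h => ⟨d, h, le_rfl⟩⟩

lemma hilb_inIdeal_eq_card (τ : MonomialOrder (MVar v n))
    (I : Ideal (MvPolynomial (MVar v n) K)) (a : Fin v → ℕ) :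
    hilb (inIdeal τ I) a =
      Nat.card {d | d ∈ leadExps τ I ∧ Finsupp.weight (wt v n) d = a} := by
  have h : (Submodule.restrictScalars K (inIdeal τ I) ⊓
        weightedHomogeneousSubmodule K (wt v n) a) =
      restrictSupport K {d | d ∈ leadExps τ I ∧ Finsupp.weight (wt v n) d = a} := by
    ext f
    rw [Submodule.mem_inf, Submodule.restrictScalars_mem, mem_inIdeal_iff,
      mem_restrictSupport_iff]
    exact ⟨fun h d hd => ⟨h.1 d hd, h.2 (by simpa using hd)⟩,
      fun h => ⟨fun d hd => (h hd).1, fun d hd => (h (by simpa using hd)).2⟩⟩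
  rw [hilb, h]
  exact Module.finrank_eq_nat_card_basis (basisRestrictSupport K _)

lemma IsMultigraded.exists_homogeneous_degree_eq {I : Ideal (MvPolynomial (MVar v n) K)}
    (hI : IsMultigraded I) (τ : MonomialOrder (MVar v n)) {d : MVar v n →₀ ℕ}
    (hd : d ∈ leadExps τ I) :
    ∃ f ∈ Submodule.restrictScalars K I ⊓
        weightedHomogeneousSubmodule K (wt v n) (Finsupp.weight (wt v n) d),
      f ≠ 0 ∧ τ.degree f = d := by
  classical
  obtain ⟨f, hf, h0, rfl⟩ := hd
  set p := weightedHomogeneousComponent (wt v n) (Finsupp.weight (wt v n) (τ.degree f)) f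
  have hc : τ.degree f ∈ p.support := by
    rw [support_weightedHomogeneousComponent, Finset.mem_filter]
    exact ⟨τ.degree_mem_support h0, rfl⟩
  refine ⟨p, ⟨hI f hf _, weightedHomogeneousComponent_mem _ _ _⟩,
    fun h => by simp [h] at hc, ?_⟩
  refine τ.toSyn.injective (le_antisymm ?_ (τ.le_degree hc))
  refine τ.degree_le_iff.2 fun e he => τ.le_degree ?_
  rw [support_weightedHomogeneousComponent, Finset.mem_filter] at he
  exact he.1

lemma linearIndependent_of_degree_eq {σ ι : Type*} (τ : MonomialOrder σ)
    (F : ι → MvPolynomial σ K) (h0 : ∀ i, F i ≠ 0)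
    (hinj : Function.Injective fun i => τ.degree (F i)) : LinearIndependent K F := by
  rw [linearIndependent_iff]
  intro c hc
  by_contra hne
  obtain ⟨i, hi, hmax⟩ := Finset.exists_max_image c.support (fun i => τ.toSyn (τ.degree (F i)))
    (Finsupp.support_nonempty_iff.2 hne)
  have h := congrArg (coeff (τ.degree (F i))) hc
  rw [Finsupp.linearCombination_apply, Finsupp.sum, coeff_sum, coeff_zero,
    Finset.sum_eq_single_of_mem i hi, coeff_smul, smul_eq_mul] at h
  · exact mul_ne_zero (Finsupp.mem_support_iff.1 hi) (τ.coeff_degree_ne_zero_iff.2 (h0 i)) h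
  · intro j hj hji
    rw [coeff_smul, τ.coeff_eq_zero_of_lt, smul_zero]
    exact lt_of_le_of_ne (hmax j hj) fun h => hji (hinj (τ.toSyn.injective h))

/-- Theorem of Macaulay: a multigraded ideal and its initial ideal have the same multigraded
Hilbert function. -/
lemma IsMultigraded.hilb_inIdeal {I : Ideal (MvPolynomial (MVar v n) K)}
    (hI : IsMultigraded I) (τ : MonomialOrder (MVar v n)) (a : Fin v → ℕ) :
    hilb (inIdeal τ I) a = hilb I a := by
  rw [hilb_inIdeal_eq_card, hilb]
  set V := Submodule.restrictScalars K I ⊓ weightedHomogeneousSubmodule K (wt v n) a with hV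
  set L := {d | d ∈ leadExps τ I ∧ Finsupp.weight (wt v n) d = a}
  have : Fintype L := ((finite_weight_eq (n := n) a).subset fun d hd => hd.2).fintype
  have : Module.Finite K V := Submodule.finiteDimensional_of_le
    (inf_le_right : V ≤ weightedHomogeneousSubmodule K (wt v n) a)
  rw [Nat.card_eq_fintype_card]
  apply le_antisymm
  · have hex : ∀ d : L, ∃ f : V, (f : MvPolynomial (MVar v n) K) ≠ 0 ∧ τ.degree f.1 = d.1 := by
      rintro ⟨d, hd, rfl⟩
      obtain ⟨f, hf, h0, hfd⟩ := hI.exists_homogeneous_degree_eq τ hd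
      exact ⟨⟨f, hf⟩, h0, hfd⟩
    choose F hF0 hFd using hex
    have hli : LinearIndependent K fun d => (F d : MvPolynomial (MVar v n) K) :=
      linearIndependent_of_degree_eq τ _ hF0 fun d e hde => Subtype.ext (by
        simpa only [hFd] using hde)
    exact (LinearIndependent.of_comp V.subtype hli).fintype_card_le_finrank
  · let φ : V →ₗ[K] (L → K) := LinearMap.pi fun d => lcoeff K d.1 ∘ₗ V.subtype
    have hφ : Function.Injective φ := by
      refine (injective_iff_map_eq_zero φ).2 fun f hf => ?_
      by_contra h0
      have h0' : (f : MvPolynomial (MVar v n) K) ≠ 0 := fun h => h0 (Subtype.ext h)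
      have hL : τ.degree f.1 ∈ L :=
        ⟨⟨f, f.2.1, h0', rfl⟩, f.2.2 (τ.coeff_degree_ne_zero_iff.2 h0')⟩
      exact τ.coeff_degree_ne_zero_iff.2 h0' (congrFun hf ⟨_, hL⟩)
    simpa using LinearMap.finrank_le_finrank_of_injective hφ

lemma eq_inIdeal_of_le {C I : Ideal (MvPolynomial (MVar v n) K)} {τ : MonomialOrder (MVar v n)}
    (hle : C ≤ inIdeal τ I) (hHS : sameHS C (inIdeal τ I)) : inIdeal τ I = C := by
  refine le_antisymm ?_ hle
  rw [inIdeal_eq_span, Ideal.span_le]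
  rintro _ ⟨d, hd, rfl⟩
  set W := weightedHomogeneousSubmodule K (wt v n) (Finsupp.weight (wt v n) d)
  have : Module.Finite K ↥(Submodule.restrictScalars K (inIdeal τ I) ⊓ W) :=
    Submodule.finiteDimensional_of_le (inf_le_right : _ ≤ W)
  have heq : Submodule.restrictScalars K C ⊓ W =
      Submodule.restrictScalars K (inIdeal τ I) ⊓ W :=
    Submodule.eq_of_le_of_finrank_eq (inf_le_inf_right W hle)
      (hHS (Finsupp.weight (wt v n) d))
  have hmem : monomial d (1 : K) ∈ Submodule.restrictScalars K (inIdeal τ I) ⊓ W := by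
    refine ⟨?_, isWeightedHomogeneous_monomial _ _ _ rfl⟩
    rw [inIdeal_eq_span]
    exact Ideal.subset_span ⟨d, hd, rfl⟩
  rw [← heq] at hmem
  exact hmem.1

end InitialIdeal

section GenericInitialIdeal

variable {K : Type} [Field K] {v : ℕ} {n : Fin v → ℕ}

/-- The lexicographic order, with its underlying type in an arbitrary universe. -/
lemma exists_monomialOrder_single_lt (σ : Type) [LinearOrder σ] [WellFoundedGT σ] :
    ∃ τ : MonomialOrder σ, ∀ j k : σ, j < k →
      τ.toSyn (Finsupp.single k 1) < τ.toSyn (Finsupp.single j 1) := by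
  let e : (σ →₀ ℕ) ≃+ ULift (Lex (σ →₀ ℕ)) :=
    (MonomialOrder.lex (σ := σ)).toSyn.trans AddEquiv.ulift.symm
  have : WellFoundedLT (Lex (σ →₀ ℕ)) := (MonomialOrder.lex (σ := σ)).wellFoundedLT_syn
  have : IsOrderedAddMonoid (ULift (Lex (σ →₀ ℕ))) :=
    { add_le_add_left := fun a b h c => add_le_add_left (α := Lex (σ →₀ ℕ)) h c.down
      add_le_add_right := fun a b h c => add_le_add_right (α := Lex (σ →₀ ℕ)) h c.down }
  have : WellFoundedLT (ULift (Lex (σ →₀ ℕ))) :=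
    ⟨InvImage.wf ULift.down (wellFounded_lt (α := Lex (σ →₀ ℕ)))⟩
  exact ⟨{ syn := ULift (Lex (σ →₀ ℕ))
           toSyn := e
           toSyn_monotone := fun a b h => (MonomialOrder.lex (σ := σ)).toSyn_monotone h },
    fun j k hjk => Finsupp.Lex.single_lt_iff.2 hjk⟩

lemma exists_respectsVarOrder (v : ℕ) (n : Fin v → ℕ) :
    ∃ τ : MonomialOrder (MVar v n), RespectsVarOrder τ := by
  obtain ⟨τ, hτ⟩ := exists_monomialOrder_single_lt (Σₗ i : Fin v, Fin (n i + 1))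
  exact ⟨τ, fun i j k hjk => hτ ⟨i, j⟩ ⟨i, k⟩ (Sigma.Lex.lt_def.2 (Or.inr ⟨rfl, hjk⟩))⟩

/-- The exponent of a power product of the first variables is the largest of its multidegree. -/
lemma RespectsVarOrder.le_Tmono_weight {τ : MonomialOrder (MVar v n)} (hτ : RespectsVarOrder τ)
    (d : MVar v n →₀ ℕ) :
    τ.toSyn d ≤ τ.toSyn (Tmono v n (Finsupp.weight (wt v n) d)) := by
  have hadd : ∀ a b, Tmono v n (a + b) = Tmono v n a + Tmono v n b := fun a b => by
    simp [Tmono, Finset.sum_add_distrib]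
  induction d using Finsupp.induction_linear with
  | zero => simp
  | add d e hd he =>
    rw [map_add, map_add, hadd, map_add]
    exact add_le_add hd he
  | single p c =>
    have hT : Tmono v n (Finsupp.weight (wt v n) (Finsupp.single p c)) =
        c • Finsupp.single (⟨p.1, 0⟩ : MVar v n) 1 := by
      rw [Tmono, Finset.sum_eq_single p.1] <;>
        simp +contextual [Finsupp.weight_single, wt]
    have hp : Finsupp.single p c = c • Finsupp.single p 1 := by simp
    rw [hT, hp, map_nsmul, map_nsmul]
    refine nsmul_le_nsmul_right ?_ c
    obtain ⟨i, j⟩ := p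
    rcases eq_or_ne j 0 with rfl | hj
    · exact le_rfl
    · exact (hτ i 0 j (Fin.pos_of_ne_zero hj)).le

lemma weight_Tmono (a : Fin v → ℕ) : Finsupp.weight (wt v n) (Tmono v n a) = a := by
  simp [Tmono, Finsupp.weight_single, wt, ← Pi.single_smul, Finset.univ_sum_single]

lemma eval_gAct (g : ∀ i : Fin v, Matrix (Fin (n i + 1)) (Fin (n i + 1)) K)
    (f : MvPolynomial (MVar v n) K) :
    eval (fun p : MVar v n => if p.2 = 0 then 1 else 0) (gAct g f) =
      eval (fun p : MVar v n => g p.1 0 p.2) f := by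
  have h : (aeval fun p : MVar v n => if p.2 = 0 then (1 : K) else 0).comp (gAct g) =
      aeval fun p : MVar v n => g p.1 0 p.2 := by
    ext1 p
    rw [AlgHom.comp_apply, gAct_X, map_sum, Finset.sum_eq_single 0] <;> simp +contextual
  exact DFunLike.congr_fun h f

lemma Tmono_mem_support {f : MvPolynomial (MVar v n) K} {a : Fin v → ℕ}
    (hf : f.IsWeightedHomogeneous (wt v n) a)
    (h : eval (fun p : MVar v n => if p.2 = 0 then 1 else 0) f ≠ 0) :
    Tmono v n a ∈ f.support := by
  rw [eval_eq] at h
  obtain ⟨d, hd, hne⟩ := Finset.exists_ne_zero_of_sum_ne_zero h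
  have hd0 : ∀ p : MVar v n, p.2 ≠ 0 → d p = 0 := by
    intro p hp
    by_contra hdp
    exact Finset.prod_ne_zero_iff.1 (right_ne_zero_of_mul hne) p
      (Finsupp.mem_support_iff.2 hdp) (by simp [hp, hdp])
  suffices Tmono v n a = d by rwa [this]
  rw [← hf (mem_support_iff.1 hd)]
  ext ⟨i, j⟩
  simp only [Tmono, weight_wt_apply, Finsupp.finsetSum_apply]
  rcases eq_or_ne j 0 with rfl | hj
  · rw [Finset.sum_eq_single i, Finset.sum_eq_single 0]
    · simp
    · exact fun k _ hk => hd0 ⟨i, k⟩ hk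
    · simp
    · intro k _ hk
      simp [hk]
    · simp
  · rw [hd0 ⟨i, j⟩ hj]
    refine Finset.sum_eq_zero fun k _ => ?_
    rw [Finsupp.single_apply, if_neg]
    intro h
    cases h
    exact hj rfl

lemma generically_forall_finset {ι : Type*} (s : Finset ι)
    (P : ι → (∀ i : Fin v, Matrix (Fin (n i + 1)) (Fin (n i + 1)) K) → Prop)
    (hP : ∀ i ∈ s, Generically (P i)) :
    ∃ h : MvPolynomial (Σ i : Fin v, Fin (n i + 1) × Fin (n i + 1)) K, h ≠ 0 ∧
      ∀ g : ∀ i : Fin v, Matrix (Fin (n i + 1)) (Fin (n i + 1)) K,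
        (∀ i, IsUnit (g i).det) →
        eval (fun q : Σ i : Fin v, Fin (n i + 1) × Fin (n i + 1) => g q.1 q.2.1 q.2.2) h ≠ 0 →
        ∀ i ∈ s, P i g := by
  choose! h h0 hh using hP
  refine ⟨∏ i ∈ s, h i, Finset.prod_ne_zero_iff.2 h0, fun g hg hne i hi => hh i hi g hg ?_⟩
  rw [map_prod] at hne
  exact Finset.prod_ne_zero_iff.1 hne i hi

/-- If a multigraded ideal is nonzero in degree `a`, then its generic initial ideals contain the
power product of the first variables of degree `a`. -/
lemma generically_Tmono_mem_inIdeal {τ : MonomialOrder (MVar v n)} (hτ : RespectsVarOrder τ)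
    (I : Ideal (MvPolynomial (MVar v n) K)) {a : Fin v → ℕ} (ha : hilb I a ≠ 0) :
    Generically fun g => monomial (Tmono v n a) (1 : K) ∈ inIdeal τ (Ideal.map (gAct g) I) := by
  obtain ⟨f, ⟨hfI, hfa⟩, hf0⟩ : ∃ f ∈ Submodule.restrictScalars K I ⊓
      weightedHomogeneousSubmodule K (wt v n) a, f ≠ 0 := by
    refine Submodule.exists_mem_ne_zero_of_ne_bot fun h => ha ?_
    rw [hilb, h, finrank_bot]
  let r : MVar v n → Σ i : Fin v, Fin (n i + 1) × Fin (n i + 1) := fun p => ⟨p.1, (0, p.2)⟩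
  have hr : Function.Injective r := by
    rintro ⟨i, j⟩ ⟨k, l⟩ h
    simp only [r, Sigma.mk.injEq] at h
    obtain ⟨rfl, h⟩ := h
    simpa using h
  refine ⟨rename r f, fun h => hf0 (rename_injective r hr (by rw [h, map_zero])),
    fun g hg hne => ?_⟩
  rw [eval_rename] at hne
  have hga := (gAct_mem_weightedHomogeneousSubmodule_iff g hg a f).2 hfa
  have hsupp : Tmono v n a ∈ (gAct g f).support :=
    Tmono_mem_support hga (by rw [eval_gAct]; exact hne)
  rw [inIdeal_eq_span]
  refine Ideal.subset_span ⟨_, ⟨gAct g f, Ideal.mem_map_of_mem _ hfI,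
    fun h => by simp [h] at hsupp, ?_⟩, rfl⟩
  refine τ.toSyn.injective (le_antisymm ?_ (τ.le_degree hsupp))
  refine τ.degree_le_iff.2 fun d hd => ?_
  rw [← hga (mem_support_iff.1 hd)]
  exact hτ.le_Tmono_weight d

lemma IsCSstar.isGin_extended {I : Ideal (MvPolynomial (MVar v n) K)} (hI : IsCSstar I)
    {τ : MonomialOrder (MVar v n)} (hτ : RespectsVarOrder τ) :
    ∃ J : Ideal (MvPolynomial (MVar v n) K), IsGin τ I J ∧ ExtendedFromT J := by
  obtain ⟨hgr, C, hC, hHS⟩ := hI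
  refine ⟨C, ?_, hC⟩
  obtain ⟨A, hA⟩ := hC
  obtain ⟨s, hsA, hs⟩ := (Submodule.fg_span_iff_fg_span_finset_subset _).1
    (IsNoetherian.noetherian (Ideal.span ((fun a => monomial (Tmono v n a) (1 : K)) '' A)))
  have hCs : C = Ideal.span (s : Set (MvPolynomial (MVar v n) K)) := hA.trans hs
  have hgen : ∀ m ∈ s, Generically fun g => m ∈ inIdeal τ (Ideal.map (gAct g) I) := by
    intro m hm
    obtain ⟨a, -, rfl⟩ := hsA hm
    have hmC : monomial (Tmono v n a) (1 : K) ∈ C := hCs ▸ Ideal.subset_span hm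
    refine generically_Tmono_mem_inIdeal hτ I (hHS a ▸ fun h => ?_)
    have : Module.Finite K ↥(Submodule.restrictScalars K C ⊓
        weightedHomogeneousSubmodule K (wt v n) a) :=
      Submodule.finiteDimensional_of_le
        (inf_le_right : _ ≤ weightedHomogeneousSubmodule K (wt v n) a)
    have hbot := Submodule.finrank_eq_zero.1 h
    have hmem : monomial (Tmono v n a) (1 : K) ∈ Submodule.restrictScalars K C ⊓
        weightedHomogeneousSubmodule K (wt v n) a :=
      ⟨hmC, isWeightedHomogeneous_monomial _ _ _ (weight_Tmono a)⟩
    rw [hbot, Submodule.mem_bot, monomial_eq_zero] at hmem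
    exact one_ne_zero hmem
  obtain ⟨h, h0, hh⟩ := generically_forall_finset s _ hgen
  refine ⟨h, h0, fun g hg hne => eq_inIdeal_of_le ?_ fun a => ?_⟩
  · rw [hCs, Ideal.span_le]
    exact hh g hg hne
  · rw [(hgr.map_gAct g hg).hilb_inIdeal, hilb_map_gAct I g hg, hHS a]

lemma IsMultigraded.isCSstar_of_isGin [Infinite K] {I J : Ideal (MvPolynomial (MVar v n) K)}
    (hI : IsMultigraded I) {τ : MonomialOrder (MVar v n)} (hJ : IsGin τ I J)
    (hT : ExtendedFromT J) : IsCSstar I := by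
  obtain ⟨h, h0, hh⟩ := hJ
  obtain ⟨g, hg, hne⟩ := exists_isUnit_det_eval_ne_zero h0
  refine ⟨hI, J, hT, fun a => ?_⟩
  rw [← hh g hg hne, (hI.map_gAct g hg).hilb_inIdeal, hilb_map_gAct I g hg]

end GenericInitialIdeal

end CSPaper


/-- A `ℤ^v`-graded ideal `I` is Cartwright-Sturmfels* iff `gin_τ(I)` is extended from
`T = K[x_{1 1},…,x_{v 1}]` for some term order `τ`, iff `gin_τ(I)` is extended from `T`
for every term order `τ`. -/
theorem CSstar_iff_gin_extended
    {K : Type} [Field K] [Infinite K] {v : ℕ} {n : Fin v → ℕ}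
    (I : Ideal (MvPolynomial (MVar v n) K)) (hI : IsMultigraded I) :
    (IsCSstar I ↔ ∃ τ : MonomialOrder (MVar v n), RespectsVarOrder τ ∧
      ∃ J : Ideal (MvPolynomial (MVar v n) K), IsGin τ I J ∧ ExtendedFromT J) ∧
    (IsCSstar I ↔ ∀ τ : MonomialOrder (MVar v n), RespectsVarOrder τ →
      ∃ J : Ideal (MvPolynomial (MVar v n) K), IsGin τ I J ∧ ExtendedFromT J) := by
  refine ⟨⟨fun h => ?_, ?_⟩, fun h τ hτ => h.isGin_extended hτ, fun h => ?_⟩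
  · obtain ⟨τ, hτ⟩ := exists_respectsVarOrder v n
    exact ⟨τ, hτ, h.isGin_extended hτ⟩
  · rintro ⟨τ, -, J, hJ, hT⟩
    exact hI.isCSstar_of_isGin hJ hT
  · obtain ⟨τ, hτ⟩ := exists_respectsVarOrder v n
    obtain ⟨J, hJ, hT⟩ := h τ hτ
    exact hI.isCSstar_of_isGin hJ hT

end
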